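/- arXiv:1407.5465 — 6 statements merged into one kernel-verified Lean document; each statement's English description precedes it below -/
import Mathlib

section
/- Let N ≥ 1, α > 0, and define ℓ_{1,α}(x) = Σ_{n=1}^N (√(x_n² + α²) − α) for x ∈ ℝ^N. Then for all x, x' ∈ ℝ^N: ℓ_{1,α}(x') ≤ ℓ_{1,α}(x) + Σ_{n=1}^N (x'_n − x_n)·x_n/√(x_n² + α²) + (1/2)·Σ_{n=1}^N (x'_n − x_n)²/√(x_n² + α²). That is, the quadratic function with gradient ∇ℓ_{1,α}(x) and diagonal curvature matrix A_{ℓ_{1,α}}(x) = Diag((x_n² + α²)^{−1/2}) is a majorant of ℓ_{1,α} at x. -/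
open Finset in
/-- Quadratic majorization of the smoothed `ℓ₁` penalty
`ℓ_{1,α}(x) = Σₙ (√(xₙ² + α²) − α)` at `x`, with gradient
`(xₙ/√(xₙ² + α²))ₙ` and diagonal curvature matrix `Diag((xₙ² + α²)^(−1/2))`. -/
theorem smoothed_l1_majorant (N : ℕ) (hN : 1 ≤ N) (α : ℝ) (hα : 0 < α)
    (x x' : Fin N → ℝ) :
    (∑ n, (Real.sqrt ((x' n) ^ 2 + α ^ 2) - α)) ≤
      (∑ n, (Real.sqrt ((x n) ^ 2 + α ^ 2) - α))
        + (∑ n, (x' n - x n) * (x n) / Real.sqrt ((x n) ^ 2 + α ^ 2))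
        + (1 / 2) * ∑ n, (x' n - x n) ^ 2 / Real.sqrt ((x n) ^ 2 + α ^ 2) := by
  rw [Finset.mul_sum, ← Finset.sum_add_distrib, ← Finset.sum_add_distrib]
  apply Finset.sum_le_sum
  intro n _
  have hs : 0 < Real.sqrt ((x n) ^ 2 + α ^ 2) := Real.sqrt_pos.mpr (by positivity)
  have hs2 : Real.sqrt ((x n) ^ 2 + α ^ 2) ^ 2 = (x n) ^ 2 + α ^ 2 :=
    Real.sq_sqrt (by positivity)
  have ht2 : Real.sqrt ((x' n) ^ 2 + α ^ 2) ^ 2 = (x' n) ^ 2 + α ^ 2 :=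
    Real.sq_sqrt (by positivity)
  generalize Real.sqrt ((x n) ^ 2 + α ^ 2) = s at *
  generalize Real.sqrt ((x' n) ^ 2 + α ^ 2) = t at *
  have key : s - α + (x' n - x n) * x n / s + 1 / 2 * ((x' n - x n) ^ 2 / s) - (t - α)
      = (t - s) ^ 2 / (2 * s) := by
    field_simp
    linear_combination hs2 - ht2
  have h0 : 0 ≤ (t - s) ^ 2 / (2 * s) := by positivity
  linarith
end

section
/- Let N ≥ 1, α > 0, β > 0, λ > 0, and define φ₁(x) = λ·log(ℓ_{1,α}(x) + β) for x ∈ ℝ^N, where ℓ_{1,α}(x) = Σ_{n=1}^N (√(x_n² + α²) − α). Then for all x, x' ∈ ℝ^N: φ₁(x') ≤ φ₁(x) + ⟨x' − x, ∇φ₁(x)⟩ + (1/2)·(λ/(ℓ_{1,α}(x) + β))·Σ_{n=1}^N (x'_n − x_n)²/√(x_n² + α²), where ∇φ₁(x) has components (λ/(ℓ_{1,α}(x) + β))·x_n/√(x_n² + α²). That is, the matrix A_{φ₁}(x) = (λ/(ℓ_{1,α}(x)+β))·Diag((x_n² + α²)^{−1/2}) satisfies the majoration condition for φ₁ at x. 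-/
/-- The matrix `A_{φ₁}(x) = (λ/(ℓ_{1,α}(x)+β))·Diag((xₙ² + α²)^(−1/2))` satisfies the
majoration condition for `φ₁(x) = λ·log(ℓ_{1,α}(x) + β)` at `x`, where
`∇φ₁(x)` has components `(λ/(ℓ_{1,α}(x) + β))·xₙ/√(xₙ² + α²)`. -/
theorem phi1_majoration (N : ℕ) (hN : 1 ≤ N) (α β lam : ℝ)
    (hα : 0 < α) (hβ : 0 < β) (hlam : 0 < lam)
    (ℓ : (Fin N → ℝ) → ℝ)
    (hℓ : ∀ x, ℓ x = ∑ n, (Real.sqrt ((x n) ^ 2 + α ^ 2) - α))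
    (φ₁ : (Fin N → ℝ) → ℝ)
    (hφ₁ : ∀ x, φ₁ x = lam * Real.log (ℓ x + β))
    (x x' : Fin N → ℝ) :
    φ₁ x' ≤ φ₁ x
        + (∑ n, (x' n - x n) * ((lam / (ℓ x + β)) * (x n) / Real.sqrt ((x n) ^ 2 + α ^ 2)))
        + (1 / 2) * ((lam / (ℓ x + β))
            * ∑ n, (x' n - x n) ^ 2 / Real.sqrt ((x n) ^ 2 + α ^ 2)) := by
  have hpos : ∀ y, 0 < ℓ y + β := by
    intro y
    have : 0 ≤ ℓ y := by
      rw [hℓ]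
      refine Finset.sum_nonneg fun n _ => ?_
      have : α ≤ Real.sqrt ((y n) ^ 2 + α ^ 2) := Real.le_sqrt_of_sq_le (by nlinarith [sq_nonneg (y n)])
      linarith
    linarith
  have ha := hpos x
  have hb := hpos x'
  have hlog : Real.log (ℓ x' + β) ≤ Real.log (ℓ x + β) + (ℓ x' - ℓ x) / (ℓ x + β) := by
    have h := Real.log_le_sub_one_of_pos (div_pos hb ha)
    rw [Real.log_div hb.ne' ha.ne'] at h
    have e : (ℓ x' + β) / (ℓ x + β) - 1 = (ℓ x' - ℓ x) / (ℓ x + β) := by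
      field_simp
      ring
    linarith
  have hl : ℓ x' - ℓ x ≤ ∑ n, ((x' n - x n) * (x n / Real.sqrt ((x n) ^ 2 + α ^ 2))
      + (1 / 2) * ((x' n - x n) ^ 2 / Real.sqrt ((x n) ^ 2 + α ^ 2))) := by
    rw [hℓ, hℓ, ← Finset.sum_sub_distrib]
    refine Finset.sum_le_sum fun n _ => ?_
    have hs : 0 < Real.sqrt ((x n) ^ 2 + α ^ 2) := Real.sqrt_pos.2 (by positivity)
    have hs2 := Real.sq_sqrt (show 0 ≤ (x n) ^ 2 + α ^ 2 by positivity)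
    have ht2 := Real.sq_sqrt (show 0 ≤ (x' n) ^ 2 + α ^ 2 by positivity)
    generalize Real.sqrt ((x n) ^ 2 + α ^ 2) = s at *
    generalize Real.sqrt ((x' n) ^ 2 + α ^ 2) = t at *
    have e : (x' n - x n) * (x n / s) + (1 / 2) * ((x' n - x n) ^ 2 / s)
        = (t ^ 2 - s ^ 2) / (2 * s) := by
      rw [hs2, ht2]
      field_simp
      ring
    rw [e, le_div_iff₀ (by positivity)]
    nlinarith [sq_nonneg (t - s)]
  have hc : 0 < lam / (ℓ x + β) := div_pos hlam ha
  have h1 := mul_le_mul_of_nonneg_left hlog hlam.le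
  have h2 := mul_le_mul_of_nonneg_left hl hc.le
  rw [Finset.sum_add_distrib, ← Finset.mul_sum, mul_add, Finset.mul_sum] at h2
  have e1 : ∑ n, (x' n - x n) * ((lam / (ℓ x + β)) * (x n) / Real.sqrt ((x n) ^ 2 + α ^ 2))
      = ∑ n, lam / (ℓ x + β) * ((x' n - x n) * (x n / Real.sqrt ((x n) ^ 2 + α ^ 2))) :=
    Finset.sum_congr rfl fun n _ => by ring
  have e2 : lam * ((ℓ x' - ℓ x) / (ℓ x + β)) = lam / (ℓ x + β) * (ℓ x' - ℓ x) := by ring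
  rw [hφ₁, hφ₁, e1]
  rw [mul_add, e2] at h1
  linarith
end

section
/- Let N ≥ 1, η > 0, λ > 0, and define φ₂(x) = −λ·log(√(‖x‖² + η²)) for x ∈ ℝ^N. Then the gradient of φ₂, namely x ↦ −λ·x/(‖x‖² + η²), is Lipschitz continuous on ℝ^N with Lipschitz constant μ = 9λ/(8η²): for all x, x' ∈ ℝ^N, ‖∇φ₂(x) − ∇φ₂(x')‖ ≤ (9λ/(8η²))·‖x − x'‖. -/
/-- The gradient of `φ₂(x) = −λ·log(√(‖x‖² + η²))`, namely `x ↦ −λ·x/(‖x‖² + η²)`, is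
Lipschitz continuous on `ℝ^N` with constant `μ = 9λ/(8η²)`. -/
theorem grad_phi2_lipschitz (N : ℕ) (hN : 1 ≤ N) (η lam : ℝ) (hη : 0 < η) (hlam : 0 < lam)
    (φ₂ : EuclideanSpace ℝ (Fin N) → ℝ)
    (hφ₂ : ∀ x, φ₂ x = -lam * Real.log (Real.sqrt (‖x‖ ^ 2 + η ^ 2)))
    (g : EuclideanSpace ℝ (Fin N) → EuclideanSpace ℝ (Fin N))
    (hg : ∀ x, g x = (-lam / (‖x‖ ^ 2 + η ^ 2)) • x) :
    (∀ x, HasGradientAt φ₂ (g x) x) ∧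
      ∀ x x' : EuclideanSpace ℝ (Fin N),
        ‖g x - g x'‖ ≤ (9 * lam / (8 * η ^ 2)) * ‖x - x'‖ := by
  have hpos : ∀ x : EuclideanSpace ℝ (Fin N), 0 < ‖x‖ ^ 2 + η ^ 2 := fun x => by positivity
  constructor
  · intro x
    have hfun : φ₂ = fun y => (-lam / 2) * Real.log (‖y‖ ^ 2 + η ^ 2) := by
      funext y
      rw [hφ₂, Real.log_sqrt (hpos y).le]
      ring
    have h1 : HasFDerivAt (fun y : EuclideanSpace ℝ (Fin N) => ‖y‖ ^ 2 + η ^ 2)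
        (2 • (innerSL ℝ x)) x :=
      (hasStrictFDerivAt_norm_sq x).hasFDerivAt.add_const _
    have h2 := (h1.log (hpos x).ne').const_mul (-lam / 2)
    rw [hasGradientAt_iff_hasFDerivAt, hfun]
    refine h2.congr_fderiv ?_
    ext y
    rw [hg]
    simp [inner_smul_left]
    field_simp
  · intro x y
    have hc : inner ℝ x y ≤ ‖x‖ * ‖y‖ := real_inner_le_norm x y
    have hp := norm_nonneg x
    have hq := norm_nonneg y
    have hA := hpos x
    have hB := hpos y
    have he : 0 < η ^ 2 := by positivity
    have hd : ‖x - y‖ ^ 2 = ‖x‖ ^ 2 - 2 * inner ℝ x y + ‖y‖ ^ 2 := norm_sub_sq_real x y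
    have hkey : η ^ 2 * ‖(‖y‖ ^ 2 + η ^ 2) • x - (‖x‖ ^ 2 + η ^ 2) • y‖
        ≤ (‖x‖ ^ 2 + η ^ 2) * (‖y‖ ^ 2 + η ^ 2) * ‖x - y‖ := by
      refine (abs_le_of_sq_le_sq' ?_ (by positivity)).2
      rw [mul_pow, mul_pow _ ‖x - y‖, hd, norm_sub_sq_real, norm_smul, norm_smul,
        inner_smul_left, inner_smul_right, Real.norm_of_nonneg hA.le, Real.norm_of_nonneg hB.le]
      simp only [conj_trivial]
      generalize inner ℝ x y = c at *
      generalize ‖x‖ = p at *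
      generalize ‖y‖ = q at *
      generalize η ^ 2 = e at *
      have h3 : 0 ≤ (p ^ 2 + e) * (q ^ 2 + e) * ((p ^ 2 + e) * (q ^ 2 + e) - e ^ 2)
          * (p * q - c) := by
        have : 0 ≤ (p ^ 2 + e) * (q ^ 2 + e) - e ^ 2 := by
          have : (p ^ 2 + e) * (q ^ 2 + e) - e ^ 2 = p^2*q^2 + e * p^2 + e*q^2 := by ring
          rw [this]; positivity
        have := sub_nonneg.2 hc
        positivity
      have h4 : (e * (e - p * q)) ^ 2 ≤ ((p ^ 2 + e) * (q ^ 2 + e)) ^ 2 := by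
        have hpq : 0 ≤ p * q := by positivity
        have h5 : 0 ≤ e * (p * q) := by positivity
        have h6 : 0 ≤ e * (p - q) ^ 2 := by positivity
        apply sq_le_sq'
        · nlinarith [sq_nonneg (p * q), sq_nonneg e]
        · nlinarith [sq_nonneg (p * q), sq_nonneg e]
      have h7 := mul_le_mul_of_nonneg_right h4 (sq_nonneg (p - q))
      linarith
    have hgs : g x - g y = (-lam / ((‖x‖ ^ 2 + η ^ 2) * (‖y‖ ^ 2 + η ^ 2))) •
        ((‖y‖ ^ 2 + η ^ 2) • x - (‖x‖ ^ 2 + η ^ 2) • y) := by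
      rw [hg, hg, smul_sub, smul_smul, smul_smul]
      congr 2 <;> field_simp
    rw [hgs, norm_smul, norm_div, norm_neg, Real.norm_of_nonneg hlam.le,
      Real.norm_of_nonneg (mul_pos hA hB).le]
    have h8 : lam / ((‖x‖ ^ 2 + η ^ 2) * (‖y‖ ^ 2 + η ^ 2)) *
        ‖(‖y‖ ^ 2 + η ^ 2) • x - (‖x‖ ^ 2 + η ^ 2) • y‖ ≤ lam / η ^ 2 * ‖x - y‖ := by
      rw [div_mul_eq_mul_div, div_mul_eq_mul_div, div_le_div_iff₀ (mul_pos hA hB) he]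
      nlinarith [mul_le_mul_of_nonneg_left hkey hlam.le]
    refine h8.trans (mul_le_mul_of_nonneg_right ?_ (norm_nonneg _))
    rw [div_le_div_iff₀ he (by positivity)]
    nlinarith [mul_pos hlam he]
end

section
/- Let N ≥ 1, η > 0, λ > 0, and define φ₂(x) = −λ·log(√(‖x‖² + η²)) for x ∈ ℝ^N. Then for all x, x' ∈ ℝ^N: φ₂(x') ≤ φ₂(x) + ⟨x' − x, ∇φ₂(x)⟩ + (9λ/(16η²))·‖x' − x‖², where ∇φ₂(x) = −λ·x/(‖x‖² + η²). That is, the matrix (9λ/(8η²))·I_N satisfies the majoration condition for φ₂ at every x. -/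
open RealInnerProductSpace

/-- The matrix `(9λ/(8η²))·I_N` satisfies the majoration condition for
`φ₂(x) = −λ·log(√(‖x‖² + η²))` at every `x`:
`φ₂(x') ≤ φ₂(x) + ⟨x' − x, ∇φ₂(x)⟩ + (9λ/(16η²))·‖x' − x‖²`,
where `∇φ₂(x) = −λ·x/(‖x‖² + η²)`. -/
theorem phi2_majoration (N : ℕ) (hN : 1 ≤ N) (η lam : ℝ) (hη : 0 < η) (hlam : 0 < lam)
    (φ₂ : EuclideanSpace ℝ (Fin N) → ℝ)
    (hφ₂ : ∀ x, φ₂ x = -lam * Real.log (Real.sqrt (‖x‖ ^ 2 + η ^ 2)))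
    (x x' : EuclideanSpace ℝ (Fin N)) :
    φ₂ x' ≤ φ₂ x + ⟪x' - x, (-lam / (‖x‖ ^ 2 + η ^ 2)) • x⟫
        + (9 * lam / (16 * η ^ 2)) * ‖x' - x‖ ^ 2 := by
  have hA : 0 < ‖x‖ ^ 2 + η ^ 2 := by positivity
  have hB : 0 < ‖x'‖ ^ 2 + η ^ 2 := by positivity
  have hs : ⟪x' - x, x⟫ = (‖x'‖ ^ 2 - ‖x‖ ^ 2 - ‖x' - x‖ ^ 2) / 2 := by
    have h := norm_add_sq_real (x' - x) x
    rw [sub_add_cancel] at h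
    linarith
  have htri : |‖x'‖ - ‖x‖| ≤ ‖x' - x‖ := abs_norm_sub_norm_le x' x
  have hd2 : (‖x'‖ - ‖x‖) ^ 2 ≤ ‖x' - x‖ ^ 2 := by
    rw [← sq_abs (‖x'‖ - ‖x‖)]
    exact pow_le_pow_left₀ (abs_nonneg _) htri 2
  rw [hφ₂, hφ₂, inner_smul_right, hs, Real.log_sqrt hA.le, Real.log_sqrt hB.le]
  generalize ‖x' - x‖ = d at *
  generalize ‖x‖ = a at *
  generalize ‖x'‖ = b at *
  have hlog : Real.log (a ^ 2 + η ^ 2) - Real.log (b ^ 2 + η ^ 2)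
      ≤ (a ^ 2 + η ^ 2) / (b ^ 2 + η ^ 2) - 1 := by
    rw [← Real.log_div hA.ne' hB.ne']
    exact Real.log_le_sub_one_of_pos (div_pos hA hB)
  have key : η ^ 2 * (a ^ 2 - b ^ 2) ^ 2 ≤ d ^ 2 * ((a ^ 2 + η ^ 2) * (b ^ 2 + η ^ 2)) := by
    have h1 : η ^ 2 * (a + b) ^ 2 ≤ (a ^ 2 + η ^ 2) * (b ^ 2 + η ^ 2) := by
      nlinarith [sq_nonneg (a * b - η ^ 2)]
    calc η ^ 2 * (a ^ 2 - b ^ 2) ^ 2 = (b - a) ^ 2 * (η ^ 2 * (a + b) ^ 2) := by ring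
      _ ≤ d ^ 2 * ((a ^ 2 + η ^ 2) * (b ^ 2 + η ^ 2)) := by gcongr
  have hq : (a ^ 2 - b ^ 2) ^ 2 / ((a ^ 2 + η ^ 2) * (b ^ 2 + η ^ 2)) ≤ d ^ 2 / η ^ 2 := by
    rw [div_le_div_iff₀ (by positivity) (by positivity)]
    linarith
  have he : (a ^ 2 + η ^ 2) / (b ^ 2 + η ^ 2) - 1 = (a ^ 2 - b ^ 2) / (a ^ 2 + η ^ 2)
      + (a ^ 2 - b ^ 2) ^ 2 / ((a ^ 2 + η ^ 2) * (b ^ 2 + η ^ 2)) := by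
    field_simp
    ring
  have p1 : 0 ≤ d ^ 2 / (a ^ 2 + η ^ 2) := by positivity
  have p2 : 0 ≤ d ^ 2 / η ^ 2 := by positivity
  have hfin : Real.log (a ^ 2 + η ^ 2) - Real.log (b ^ 2 + η ^ 2)
      ≤ (a ^ 2 - b ^ 2) / (a ^ 2 + η ^ 2) + d ^ 2 / (a ^ 2 + η ^ 2)
        + 9 / 8 * (d ^ 2 / η ^ 2) := by linarith
  have hm := mul_le_mul_of_nonneg_left hfin (by positivity : 0 ≤ lam / 2)
  have e1 : -lam / (a ^ 2 + η ^ 2) * ((b ^ 2 - a ^ 2 - d ^ 2) / 2)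
      + 9 * lam / (16 * η ^ 2) * d ^ 2
      = lam / 2 * ((a ^ 2 - b ^ 2) / (a ^ 2 + η ^ 2) + d ^ 2 / (a ^ 2 + η ^ 2)
        + 9 / 8 * (d ^ 2 / η ^ 2)) := by
    field_simp
    ring
  linarith
end

section
/- Let N ≥ 1, (λ, β, α, η) ∈ (0, ∞)⁴, and define the smoothed one-over-two penalty φ(x) = λ·log((ℓ_{1,α}(x) + β)/ℓ_{2,η}(x)) for x ∈ ℝ^N, where ℓ_{1,α}(x) = Σ_{n=1}^N (√(x_n² + α²) − α) and ℓ_{2,η}(x) = √(‖x‖² + η²). Then for all x, x' ∈ ℝ^N: φ(x') ≤ φ(x) + ⟨x' − x, ∇φ(x)⟩ + (1/2)·[(9λ/(8η²))·‖x' − x‖² + (λ/(ℓ_{1,α}(x) + β))·Σ_{n=1}^N (x'_n − x_n)²/√(x_n² + α²)]. That is, the matrix A(x) = (9λ/(8η²))·I_N + (λ/(ℓ_{1,α}(x)+β))·Diag((x_n² + α²)^{−1/2}) satisfies the majoration condition for φ at x. -/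
open RealInnerProductSpace


lemma sot_sqrt_tangent (a b α : ℝ) (hα : 0 < α) :
    Real.sqrt (b ^ 2 + α ^ 2) ≤ Real.sqrt (a ^ 2 + α ^ 2)
      + a * (b - a) / Real.sqrt (a ^ 2 + α ^ 2)
      + (1 / 2) * ((b - a) ^ 2 / Real.sqrt (a ^ 2 + α ^ 2)) := by
  have hs : 0 < Real.sqrt (a ^ 2 + α ^ 2) := Real.sqrt_pos.2 (by positivity)
  have h1 := Real.sq_sqrt (show 0 ≤ a ^ 2 + α ^ 2 by positivity)
  have h2 := Real.sq_sqrt (show 0 ≤ b ^ 2 + α ^ 2 by positivity)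
  set s := Real.sqrt (a ^ 2 + α ^ 2)
  set t := Real.sqrt (b ^ 2 + α ^ 2)
  have : s + a * (b - a) / s + (1 / 2) * ((b - a) ^ 2 / s)
      = (2 * s ^ 2 + (b ^ 2 - a ^ 2)) / (2 * s) := by
    field_simp
    ring
  rw [this, le_div_iff₀ (by positivity)]
  nlinarith [sq_nonneg (s - t)]

/-- scalar form of the bound for the log-norm term -/
lemma sot_log_bound (r p D η : ℝ) (hη : 0 < η) (hr : 0 ≤ r) (hD : 0 ≤ D)
    (hr' : 0 ≤ r + 2 * p + D) (hp : p ^ 2 ≤ D * r) :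
    -(1 / 2) * Real.log (r + 2 * p + D + η ^ 2) ≤ -(1 / 2) * Real.log (r + η ^ 2)
      - p / (r + η ^ 2) + 9 / (16 * η ^ 2) * D := by
  have hs : 0 < r + η ^ 2 := by positivity
  have hs' : 0 < r + 2 * p + D + η ^ 2 := by positivity
  have hl := Real.log_le_sub_one_of_pos (div_pos hs hs')
  rw [Real.log_div hs.ne' hs'.ne'] at hl
  have hq : 0 ≤ (r + 2 * p + D) * r - (p + r) ^ 2 := by nlinarith
  have key : 8 * η ^ 2 * (4 * r + 2 * p - (r + η ^ 2))
      ≤ 9 * ((r + η ^ 2) * (r + 2 * p + D + η ^ 2)) := by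
    nlinarith [sq_nonneg (9 * (p + r) - 8 * η ^ 2), mul_nonneg (sq_nonneg η) hr,
      mul_nonneg (sq_nonneg η) hr', sq_nonneg (η ^ 2)]
  have key2 : 8 * η ^ 2 * (4 * p ^ 2 + 2 * p * D - D * (r + η ^ 2))
      ≤ 9 * D * ((r + η ^ 2) * (r + 2 * p + D + η ^ 2)) := by
    have h1 := mul_le_mul_of_nonneg_left key hD
    have h2 := mul_le_mul_of_nonneg_left hp (show 0 ≤ 32 * η ^ 2 by positivity)
    nlinarith
  have e : (1 / 2) * ((r + η ^ 2) / (r + 2 * p + D + η ^ 2) - 1) + p / (r + η ^ 2)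
      = (4 * p ^ 2 + 2 * p * D - D * (r + η ^ 2))
        / (2 * ((r + η ^ 2) * (r + 2 * p + D + η ^ 2))) := by
    field_simp
    ring
  have e2 : (4 * p ^ 2 + 2 * p * D - D * (r + η ^ 2))
        / (2 * ((r + η ^ 2) * (r + 2 * p + D + η ^ 2))) ≤ 9 / (16 * η ^ 2) * D := by
    rw [div_mul_eq_mul_div, div_le_div_iff₀ (by positivity) (by positivity)]
    nlinarith
  linarith

/-- The matrix `A(x) = (9λ/(8η²))·I_N + (λ/(ℓ_{1,α}(x)+β))·Diag((xₙ² + α²)^(−1/2))`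
satisfies the majoration condition for the smoothed one-over-two penalty
`φ(x) = λ·log((ℓ_{1,α}(x) + β)/ℓ_{2,η}(x))` at every `x`. -/
theorem sot_penalty_majoration (N : ℕ) (hN : 1 ≤ N) (lam β α η : ℝ)
    (hlam : 0 < lam) (hβ : 0 < β) (hα : 0 < α) (hη : 0 < η)
    (ℓ : EuclideanSpace ℝ (Fin N) → ℝ)
    (hℓ : ∀ x, ℓ x = ∑ n, (Real.sqrt ((x n) ^ 2 + α ^ 2) - α))
    (φ : EuclideanSpace ℝ (Fin N) → ℝ)
    (hφ : ∀ x, φ x = lam * Real.log ((ℓ x + β) / Real.sqrt (‖x‖ ^ 2 + η ^ 2)))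
    (x x' : EuclideanSpace ℝ (Fin N)) :
    φ x' ≤ φ x + ⟪x' - x, gradient φ x⟫
        + (1 / 2) * ((9 * lam / (8 * η ^ 2)) * ‖x' - x‖ ^ 2
            + (lam / (ℓ x + β))
              * ∑ n, (x' n - x n) ^ 2 / Real.sqrt ((x n) ^ 2 + α ^ 2)) := by
  have hsq : ∀ (y : EuclideanSpace ℝ (Fin N)) n, 0 < Real.sqrt ((y n) ^ 2 + α ^ 2) :=
    fun y n => Real.sqrt_pos.2 (by positivity)
  have hℓ0 : ∀ y, 0 ≤ ℓ y := by
    intro y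
    rw [hℓ]
    refine Finset.sum_nonneg fun n _ => sub_nonneg.2 (Real.le_sqrt_of_sq_le ?_)
    nlinarith [sq_nonneg (y n)]
  have hL : ∀ y, 0 < ℓ y + β := fun y => by linarith [hℓ0 y]
  have hS : ∀ y : EuclideanSpace ℝ (Fin N), 0 < ‖y‖ ^ 2 + η ^ 2 := fun y => by positivity
  have hφ2 : ∀ y, φ y = lam * (Real.log (ℓ y + β) - (1 / 2) * Real.log (‖y‖ ^ 2 + η ^ 2)) := by
    intro y
    rw [hφ, Real.log_div (hL y).ne' (Real.sqrt_pos.2 (hS y)).ne', Real.log_sqrt (hS y).le]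
    ring
  -- derivative of φ at x
  have hdℓ : HasFDerivAt ℓ (∑ n, (x n / Real.sqrt ((x n) ^ 2 + α ^ 2)) •
      (EuclideanSpace.proj n : EuclideanSpace ℝ (Fin N) →L[ℝ] ℝ)) x := by
    have : ℓ = fun y => ∑ n, (Real.sqrt ((y n) ^ 2 + α ^ 2) - α) := funext hℓ
    rw [this]
    refine HasFDerivAt.fun_sum fun n _ => ?_
    have h1 : HasFDerivAt (fun y : EuclideanSpace ℝ (Fin N) => y n)
        (EuclideanSpace.proj n : EuclideanSpace ℝ (Fin N) →L[ℝ] ℝ) x :=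
      (EuclideanSpace.proj n : EuclideanSpace ℝ (Fin N) →L[ℝ] ℝ).hasFDerivAt
    have h2 : HasDerivAt (fun t : ℝ => Real.sqrt (t ^ 2 + α ^ 2) - α)
        (x n / Real.sqrt ((x n) ^ 2 + α ^ 2)) (x n) := by
      have h0 : HasDerivAt (fun t : ℝ => t ^ 2 + α ^ 2) (2 * x n) (x n) := by
        simpa using (hasDerivAt_pow 2 (x n)).add_const (α ^ 2)
      have h3 := (h0.sqrt (show (x n) ^ 2 + α ^ 2 ≠ 0 by positivity)).sub_const α
      have e : 2 * x n / (2 * Real.sqrt ((x n) ^ 2 + α ^ 2))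
          = x n / Real.sqrt ((x n) ^ 2 + α ^ 2) := mul_div_mul_left _ _ two_ne_zero
      rwa [e] at h3
    exact h2.comp_hasFDerivAt x h1
  have hdn : HasFDerivAt (fun y : EuclideanSpace ℝ (Fin N) => ‖y‖ ^ 2)
      (2 • (innerSL ℝ x)) x := (hasStrictFDerivAt_norm_sq x).hasFDerivAt
  have hdφ : HasFDerivAt φ (lam • ((ℓ x + β)⁻¹ • (∑ n, (x n / Real.sqrt ((x n) ^ 2 + α ^ 2)) •
      (EuclideanSpace.proj n : EuclideanSpace ℝ (Fin N) →L[ℝ] ℝ))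
      - (1 / 2 : ℝ) • ((‖x‖ ^ 2 + η ^ 2)⁻¹ • (2 • (innerSL ℝ x))))) x := by
    rw [funext hφ2]
    exact ((((hdℓ.add_const β).log (hL x).ne').sub
      (((hdn.add_const (η ^ 2)).log (hS x).ne').const_mul (1 / 2))).const_mul lam)
  have hg : ⟪x' - x, gradient φ x⟫ = lam * ((ℓ x + β)⁻¹ *
      (∑ n, x n * (x' n - x n) / Real.sqrt ((x n) ^ 2 + α ^ 2))
      - inner ℝ x (x' - x) / (‖x‖ ^ 2 + η ^ 2)) := by
    rw [real_inner_comm, gradient, InnerProductSpace.toDual_symm_apply, hdφ.fderiv]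
    simp only [smul_apply, sub_apply,
      sum_apply, innerSL_apply_apply, smul_eq_mul,
      nsmul_eq_mul]
    congr 2
    · congr 1
      refine Finset.sum_congr rfl fun n _ => ?_
      have e : (EuclideanSpace.proj n : EuclideanSpace ℝ (Fin N) →L[ℝ] ℝ) (x' - x)
          = x' n - x n := rfl
      rw [e]
      ring
    · push_cast
      ring
  have hlog : Real.log (ℓ x' + β) ≤ Real.log (ℓ x + β) + (ℓ x + β)⁻¹ * (ℓ x' - ℓ x) := by
    have h := Real.log_le_sub_one_of_pos (div_pos (hL x') (hL x))
    rw [Real.log_div (hL x').ne' (hL x).ne'] at h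
    have e : (ℓ x' + β) / (ℓ x + β) - 1 = (ℓ x + β)⁻¹ * (ℓ x' - ℓ x) := by
      have := (hL x).ne'
      field_simp
      ring
    linarith
  have hdiff : ℓ x' - ℓ x ≤ (∑ n, x n * (x' n - x n) / Real.sqrt ((x n) ^ 2 + α ^ 2))
      + (1 / 2) * ∑ n, (x' n - x n) ^ 2 / Real.sqrt ((x n) ^ 2 + α ^ 2) := by
    rw [hℓ, hℓ, ← Finset.sum_sub_distrib, Finset.mul_sum, ← Finset.sum_add_distrib]
    refine Finset.sum_le_sum fun n _ => ?_
    linarith [sot_sqrt_tangent (x n) (x' n) α hα]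
  have hinv := mul_le_mul_of_nonneg_left hdiff (inv_pos.2 (hL x)).le
  have hx' : ‖x'‖ ^ 2 = ‖x‖ ^ 2 + 2 * inner ℝ x (x' - x) + ‖x' - x‖ ^ 2 := by
    rw [← norm_add_sq_real, add_sub_cancel]
  have hcs : (inner ℝ x (x' - x)) ^ 2 ≤ ‖x' - x‖ ^ 2 * ‖x‖ ^ 2 := by
    rw [← mul_pow, mul_comm, ← sq_abs]
    exact pow_le_pow_left₀ (abs_nonneg _) (abs_real_inner_le_norm _ _) 2
  have hb := sot_log_bound (‖x‖ ^ 2) (inner ℝ x (x' - x)) (‖x' - x‖ ^ 2) η hη (by positivity)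
    (by positivity) (by rw [← hx']; positivity) hcs
  rw [← hx'] at hb
  rw [hg, hφ2 x', hφ2 x]
  set T := ∑ n, (x' n - x n) ^ 2 / Real.sqrt ((x n) ^ 2 + α ^ 2)
  set U := ∑ n, x n * (x' n - x n) / Real.sqrt ((x n) ^ 2 + α ^ 2)
  have hfin : Real.log (ℓ x' + β) - (1 / 2) * Real.log (‖x'‖ ^ 2 + η ^ 2)
      ≤ (Real.log (ℓ x + β) - (1 / 2) * Real.log (‖x‖ ^ 2 + η ^ 2))
      + ((ℓ x + β)⁻¹ * U - inner ℝ x (x' - x) / (‖x‖ ^ 2 + η ^ 2))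
      + (1 / 2) * (9 / (8 * η ^ 2) * ‖x' - x‖ ^ 2 + (ℓ x + β)⁻¹ * T) := by
    have e : 9 / (16 * η ^ 2) * ‖x' - x‖ ^ 2 = (1 / 2) * (9 / (8 * η ^ 2) * ‖x' - x‖ ^ 2) := by
      field_simp
      ring
    linarith
  refine (mul_le_mul_of_nonneg_left hfin hlam.le).trans_eq ?_
  ring
end

section
/- Let N ≥ 1, (λ, β, α, η) ∈ (0, ∞)⁴, and define the smoothed one-over-two penalty φ(x) = λ·log((ℓ_{1,α}(x) + β)/ℓ_{2,η}(x)) for x ∈ ℝ^N, where ℓ_{1,α}(x) = Σ_{n=1}^N (√(x_n² + α²) − α) and ℓ_{2,η}(x) = √(‖x‖² + η²). Then φ is differentiable on ℝ^N and its gradient ∇φ is Lipschitz continuous on every bounded convex subset of ℝ^N: for every bounded convex set C ⊆ ℝ^N there exists L ≥ 0 such that for all x, x' ∈ C, ‖∇φ(x) − ∇φ(x')‖ ≤ L·‖x − x'‖. -/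
/-- The smoothed one-over-two penalty `φ(x) = λ·log((ℓ_{1,α}(x) + β)/ℓ_{2,η}(x))` is
differentiable on `ℝ^N` and its gradient is Lipschitz continuous on every bounded
convex subset of `ℝ^N`. -/
theorem sot_penalty_grad_lipschitz_on_bounded (N : ℕ) (hN : 1 ≤ N) (lam β α η : ℝ)
    (hlam : 0 < lam) (hβ : 0 < β) (hα : 0 < α) (hη : 0 < η)
    (φ : EuclideanSpace ℝ (Fin N) → ℝ)
    (hφ : ∀ x, φ x = lam * Real.log
        (((∑ n, (Real.sqrt ((x n) ^ 2 + α ^ 2) - α)) + β) / Real.sqrt (‖x‖ ^ 2 + η ^ 2))) :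
    Differentiable ℝ φ ∧
      ∀ C : Set (EuclideanSpace ℝ (Fin N)), Convex ℝ C → Bornology.IsBounded C →
        ∃ L : ℝ, 0 ≤ L ∧ ∀ x ∈ C, ∀ x' ∈ C,
          ‖gradient φ x - gradient φ x'‖ ≤ L * ‖x - x'‖ := by
  have hpos : ∀ x : EuclideanSpace ℝ (Fin N),
      0 < (∑ n, (Real.sqrt ((x n) ^ 2 + α ^ 2) - α)) + β := by
    intro x
    have : 0 ≤ ∑ n, (Real.sqrt ((x n) ^ 2 + α ^ 2) - α) := by
      refine Finset.sum_nonneg fun n _ => ?_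
      have : α ≤ Real.sqrt ((x n) ^ 2 + α ^ 2) :=
        Real.le_sqrt_of_sq_le (by nlinarith [sq_nonneg (x n)])
      linarith
    linarith
  have hpos2 : ∀ x : EuclideanSpace ℝ (Fin N), 0 < Real.sqrt (‖x‖ ^ 2 + η ^ 2) := by
    intro x
    positivity
  have hc : ContDiff ℝ 2 φ := by
    have e : φ = _ := funext hφ
    rw [e]
    refine contDiff_const.mul (ContDiff.log (ContDiff.div ?_ ?_ ?_) ?_)
    · refine ContDiff.add (ContDiff.sum fun n _ => ContDiff.sub (ContDiff.sqrt ?_ ?_)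
        contDiff_const) contDiff_const
      · fun_prop
      · intro x
        positivity
    · refine ContDiff.sqrt ((contDiff_norm_sq ℝ).add contDiff_const) ?_
      intro x
      positivity
    · exact fun x => (hpos2 x).ne'
    · exact fun x => (div_pos (hpos x) (hpos2 x)).ne'
  refine ⟨hc.differentiable (by norm_num), fun C _ hC => ?_⟩
  obtain ⟨r, hr⟩ := hC.subset_closedBall 0
  have h1 : ContDiff ℝ 1 (fderiv ℝ φ) := hc.fderiv_right (by norm_num)
  obtain ⟨K, hK⟩ := h1.contDiffOn.exists_lipschitzOnWith (s := Metric.closedBall 0 r)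
    (by norm_num) (convex_closedBall _ _) (isCompact_closedBall _ _)
  refine ⟨K, K.2, fun x hx y hy => ?_⟩
  have := hK.dist_le_mul x (hr hx) y (hr hy)
  rw [dist_eq_norm, dist_eq_norm] at this
  unfold gradient
  rw [← map_sub, LinearIsometryEquiv.norm_map]
  exact this
end
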